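/- Let Ω ⊂ ℝⁿ be a bounded domain with Lipschitz boundary, and suppose β > α ≥ 0, β ≥ 2, α + β > n, and 1 ≤ p ≤ 2β. Then there exist constants C, C₁ > 0 such that for all u ∈ C²(Ω̄) with u and ∇u vanishing on ∂Ω and every i ∈ {1,…,n}, ‖D_i u‖_{L^p(Ω)}^p ≤ C [u]_{S̊₂}^{2β} + C₁, where [u]_{S̊₂} := ( ∑_{i=1}^n ∫_Ω |u|^α |D_i² u|^β dx )^{1/(α+β)}. In particular the embedding S̊_{2,α,β}(Ω) ⊂ W₀^{1,p}(Ω) holds. -/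

import Mathlib

open MeasureTheory Real Set
open Filter Topology

theorem countable_setOf_eq_zero_hasDerivAt_ne_zero (f f' : ℝ → ℝ) :
    {t | f t = 0 ∧ HasDerivAt f (f' t) t ∧ f' t ≠ 0}.Countable := by
  set S := {t | f t = 0 ∧ HasDerivAt f (f' t) t ∧ f' t ≠ 0}
  refine (countable_setOfPred_isolated_right_within (s := S)).mono fun t ht =>
    (⟨ht, ?_⟩ : t ∈ S ∧ 𝓝[S ∩ Ioi t] t = ⊥)
  have h := ht.2.1.eventually_ne (c := 0) ht.2.2
  rw [← empty_mem_iff_bot]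
  have h' := nhdsWithin_mono t (fun y (hy : y ∈ S ∩ Ioi t) => (ne_of_gt hy.2 : y ≠ t)) h
  filter_upwards [h', self_mem_nhdsWithin] with y hy hy'
  exact hy hy'.1.1

theorem exists_smooth_threshold {δ : ℝ} (hδ : 0 < δ) :
    ∃ φ h : ℝ → ℝ, Continuous h ∧ (∀ t, 0 ≤ h t ∧ h t ≤ 1) ∧ (∀ t, HasDerivAt φ (h t) t) ∧
      (∀ t, |φ t| ≤ |t|) ∧ (∀ t, |t| < δ → φ t = 0) ∧ ∀ t, 2 * δ ≤ |t| → h t = 1 := by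
  set h : ℝ → ℝ := fun t => min 1 (max 0 (|t| / δ - 1)) with hh
  have hc : Continuous h := by fun_prop
  have h01 : ∀ t, 0 ≤ h t ∧ h t ≤ 1 := fun t =>
    ⟨le_min zero_le_one (le_max_left _ _), min_le_left _ _⟩
  have bound : ∀ (t c : ℝ), (∀ s ∈ uIoc 0 t, h s ≤ c) → |∫ s in (0)..t, h s| ≤ c * |t| := by
    intro t c hcc
    have := intervalIntegral.norm_integral_le_of_norm_le_const (f := h) (a := 0) (b := t) (C := c)
      (fun s hs => by rw [Real.norm_eq_abs, abs_of_nonneg (h01 s).1]; exact hcc s hs)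
    simpa using this
  refine ⟨fun t => ∫ s in (0)..t, h s, h, hc, h01,
    fun t => intervalIntegral.integral_hasDerivAt_right (hc.intervalIntegrable _ _)
      hc.aestronglyMeasurable.stronglyMeasurableAtFilter hc.continuousAt, fun t => ?_,
    fun t ht => ?_, fun t ht => ?_⟩
  · simpa using bound t 1 fun s _ => (h01 s).2
  · have := bound t 0 fun s hs => ?_
    · simpa using this
    · have hs' : |s| ≤ |t| := by
        have := abs_sub_left_of_mem_uIcc (uIoc_subset_uIcc hs)
        simpa using this
      have : |s| / δ - 1 ≤ 0 := by
        rw [sub_nonpos, div_le_one hδ]; linarith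
      simp [hh, this]
  · have : 1 ≤ |t| / δ - 1 := by
      rw [le_sub_iff_add_le, le_div_iff₀ hδ]; linarith
    simp only [hh]
    rw [max_eq_right (by linarith), min_eq_left this]

theorem hasDerivAt_abs_rpow_mul_self {q : ℝ} (hq : 4 ≤ q) (s : ℝ) :
    HasDerivAt (fun s : ℝ => |s| ^ (q - 2) * s) ((q - 1) * |s| ^ (q - 2)) s := by
  have h := (hasDerivAt_abs_rpow s (p := q - 2) (by linarith)).mul (hasDerivAt_id s)
  refine h.congr_deriv ?_
  have : |s| ^ (q - 2 - 2) * (s * s) = |s| ^ (q - 2) := by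
    rcases eq_or_ne s 0 with rfl | hs
    · rw [abs_zero, Real.zero_rpow (x := q - 2) (by linarith)]; simp
    · rw [Real.rpow_sub (abs_pos.2 hs) (q - 2) 2, Real.rpow_two, sq_abs]
      field_simp
  simp only [id]
  linear_combination (q - 2) * this

section

variable {E : Type*} [NormedAddCommGroup E]

theorem eventually_abs_lt_of_notMem {Ω : Set E} {u : E → ℝ}
    (hu : ContinuousOn u (closure Ω)) (h0 : ∀ x ∈ frontier Ω, u x = 0) {x : E} (hx : x ∉ Ω)
    {δ : ℝ} (hδ : 0 < δ) : ∀ᶠ y in 𝓝 x, y ∈ Ω → |u y| < δ := by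
  by_cases hc : x ∈ closure Ω
  · have hux : u x = 0 := h0 x ⟨hc, fun h => hx (interior_subset h)⟩
    have := ((hu x hc).abs).eventually_lt_const (u := δ) (by simpa [hux] using hδ)
    filter_upwards [eventually_nhdsWithin_iff.1 this] with y hy hyΩ
    exact hy (subset_closure hyΩ)
  · filter_upwards [isClosed_closure.isOpen_compl.mem_nhds hc] with y hy hyΩ
    exact absurd (subset_closure hyΩ) hy

variable [MeasurableSpace E] [BorelSpace E] {μ : Measure E}

theorem integrableOn_of_continuousOn_of_bound {Ω : Set E} (hΩ : IsOpen Ω) (hμ : μ Ω < ⊤)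
    {f : E → ℝ} (hf : ContinuousOn f Ω) {B : ℝ} (hB : ∀ x ∈ Ω, |f x| ≤ B) :
    IntegrableOn f Ω μ :=
  IntegrableOn.of_bound hμ (hf.aestronglyMeasurable hΩ.measurableSet) B
    ((ae_restrict_iff' hΩ.measurableSet).2 (ae_of_all _ hB))

variable [NormedSpace ℝ E] [FiniteDimensional ℝ E] [μ.IsAddHaarMeasure]

theorem ae_lineDeriv_eq_zero_of_eq_zero {Ω : Set E} (hΩ : IsOpen Ω) {u w : E → ℝ} {v : E}
    (hu : ContinuousOn u Ω) (hw : ContinuousOn w Ω)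
    (hd : ∀ x ∈ Ω, HasLineDerivAt ℝ u (w x) x v) :
    ∀ᵐ x ∂μ, x ∈ Ω → u x = 0 → w x = 0 := by
  have hms : MeasurableSet ((Ω \ (Ω ∩ u ⁻¹' {0}ᶜ)) ∩ (Ω ∩ w ⁻¹' {0}ᶜ))ᶜ :=
    ((hΩ.measurableSet.diff
      (hu.isOpen_inter_preimage hΩ isOpen_compl_singleton).measurableSet).inter
      (hw.isOpen_inter_preimage hΩ isOpen_compl_singleton).measurableSet).compl
  have := ae_mem_of_ae_add_linearMap_mem (LinearMap.toSpanSingleton ℝ E v) volume μ hms fun y => ?_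
  · filter_upwards [this] with x hx hxΩ hux
    by_contra hwx
    exact hx ⟨⟨hxΩ, fun h => h.2 hux⟩, hxΩ, hwx⟩
  · have hcount := countable_setOf_eq_zero_hasDerivAt_ne_zero (fun t => u (y + t • v))
      (fun t => w (y + t • v))
    refine (measure_mono_null ?_ (hcount.measure_zero volume) :)
    intro t ht
    simp only [mem_compl_iff, mem_ofPred_eq, LinearMap.toSpanSingleton_apply, not_not] at ht
    obtain ⟨⟨hΩt, h1⟩, -, h2⟩ := ht
    refine ⟨by_contra fun h => h1 ⟨hΩt, h⟩, ?_, h2⟩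
    have := hd _ hΩt
    unfold HasLineDerivAt at this
    have h3 := HasDerivAt.comp_sub_const (f := fun s => u (y + t • v + s • v)) t t
      (f' := w (y + t • v)) (by simpa using this)
    refine h3.congr_of_eventuallyEq (Eventually.of_forall fun s => ?_)
    simp only [add_assoc, ← add_smul]
    congr 3; ring

theorem integral_lineDeriv_eq_zero {g g' : E → ℝ} {v : E} (hg : Integrable g μ)
    (hg' : Integrable g' μ) (hd : ∀ x, HasLineDerivAt ℝ g (g' x) x v) : ∫ x, g' x ∂μ = 0 := by
  have := integral_bilinear_hasLineDerivAt_right_eq_neg_left_of_integrable (μ := μ) (v := v)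
    (B := ContinuousLinearMap.mul ℝ ℝ) (f := fun _ => (1 : ℝ)) (f' := fun _ => 0) (g := g)
    (g' := g') (by simp) (by simpa using hg') (by simpa using hg)
    (fun x _ => by simpa [HasLineDerivAt] using hasDerivAt_const (0 : ℝ) (1 : ℝ)) (fun x _ => hd x)
  simpa using this

theorem setIntegral_threshold_mul_abs_rpow_le {Ω : Set E} (hΩ : IsOpen Ω) (hμ : μ Ω < ⊤)
    {u w z : E → ℝ} {v : E} {q B δ : ℝ} (hq : 4 ≤ q) (hδ : 0 < δ)
    (hu : ContinuousOn u (closure Ω)) (h0 : ∀ x ∈ frontier Ω, u x = 0)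
    (hw : ContinuousOn w Ω) (hz : ContinuousOn z Ω)
    (hdu : ∀ x ∈ Ω, HasLineDerivAt ℝ u (w x) x v)
    (hdw : ∀ x ∈ Ω, HasLineDerivAt ℝ w (z x) x v)
    (hBu : ∀ x ∈ Ω, |u x| ≤ B) (hBw : ∀ x ∈ Ω, |w x| ≤ B) (hBz : ∀ x ∈ Ω, |z x| ≤ B)
    {φ h : ℝ → ℝ} (hh : Continuous h) (h01 : ∀ t, 0 ≤ h t ∧ h t ≤ 1)
    (hφd : ∀ t, HasDerivAt φ (h t) t) (hφ : ∀ t, |φ t| ≤ |t|) (hφ0 : ∀ t, |t| < δ → φ t = 0) :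
    ∫ x in Ω, h (u x) * |w x| ^ q ∂μ ≤ (q - 1) * ∫ x in Ω, |u x| * |w x| ^ (q - 2) * |z x| ∂μ := by
  have huΩ : ContinuousOn u Ω := hu.mono subset_closure
  have hφc : Continuous φ := continuous_iff_continuousAt.2 fun t => (hφd t).continuousAt
  have hpow : ∀ r : ℝ, 0 ≤ r → ContinuousOn (fun x => |w x| ^ r) Ω := fun r hr =>
    hw.abs.rpow_const fun _ _ => Or.inr hr
  have hB : ∀ x ∈ Ω, 0 ≤ B := fun x hx => (abs_nonneg _).trans (hBu x hx)
  have hφB : ∀ x ∈ Ω, |φ (u x)| ≤ B := fun x hx => (hφ _).trans (hBu x hx)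
  have hφu : ContinuousOn (fun x => φ (u x)) Ω := hφc.comp_continuousOn huΩ
  have hhu : ContinuousOn (fun x => h (u x)) Ω := hh.comp_continuousOn huΩ
  have hq2 : (0 : ℝ) ≤ q - 2 := by linarith
  have hq0 : (0 : ℝ) ≤ q := by linarith
  have habs : ∀ (x : E) (r : ℝ), |(|w x| ^ r)| = |w x| ^ r := fun x r =>
    abs_of_nonneg (Real.rpow_nonneg (abs_nonneg _) _)
  have i1 : IntegrableOn (fun x => φ (u x) * (|w x| ^ (q - 2) * w x)) Ω μ := by
    refine integrableOn_of_continuousOn_of_bound hΩ hμ (hφu.mul ((hpow _ hq2).mul hw))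
      (B := B * (B ^ (q - 2) * B)) fun x hx => ?_
    have := hB x hx
    rw [abs_mul, abs_mul, habs]
    gcongr
    exacts [hφB x hx, hBw x hx, hBw x hx]
  have i2 : IntegrableOn (fun x => h (u x) * |w x| ^ q) Ω μ := by
    refine integrableOn_of_continuousOn_of_bound hΩ hμ (hhu.mul (hpow _ hq0))
      (B := 1 * B ^ q) fun x hx => ?_
    rw [abs_mul, habs, abs_of_nonneg (h01 _).1]
    gcongr
    exacts [(h01 _).2, hBw x hx]
  have i3 : IntegrableOn (fun x => φ (u x) * ((q - 1) * |w x| ^ (q - 2) * z x)) Ω μ := by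
    refine integrableOn_of_continuousOn_of_bound hΩ hμ
      (hφu.mul ((continuousOn_const.mul (hpow _ hq2)).mul hz))
      (B := B * ((q - 1) * B ^ (q - 2) * B)) fun x hx => ?_
    have := hB x hx
    have hq1 : (0 : ℝ) ≤ q - 1 := by linarith
    rw [abs_mul, abs_mul, abs_mul, habs, abs_of_nonneg hq1]
    gcongr
    exacts [hφB x hx, hBw x hx, hBz x hx]
  have i4 : IntegrableOn (fun x => |u x| * |w x| ^ (q - 2) * |z x|) Ω μ := by
    refine integrableOn_of_continuousOn_of_bound hΩ hμ ((huΩ.abs.mul (hpow _ hq2)).mul hz.abs)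
      (B := B * B ^ (q - 2) * B) fun x hx => ?_
    have := hB x hx
    rw [abs_mul, abs_mul, habs, abs_abs, abs_abs]
    gcongr
    exacts [hBu x hx, hBw x hx, hBz x hx]
  have key := integral_lineDeriv_eq_zero (μ := μ) (v := v)
    (g := Ω.indicator fun x => φ (u x) * (|w x| ^ (q - 2) * w x))
    (g' := Ω.indicator fun x => h (u x) * |w x| ^ q +
      φ (u x) * ((q - 1) * |w x| ^ (q - 2) * z x))
    (i1.integrable_indicator hΩ.measurableSet)
    ((i2.add i3).integrable_indicator hΩ.measurableSet) fun x => ?_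
  · rw [integral_indicator hΩ.measurableSet, integral_add i2 i3] at key
    rw [eq_neg_of_add_eq_zero_left key, ← integral_neg, ← integral_const_mul]
    refine integral_mono i3.neg (i4.const_mul _) fun x => ?_
    have hq1 : (0 : ℝ) ≤ q - 1 := by linarith
    calc -(φ (u x) * ((q - 1) * |w x| ^ (q - 2) * z x))
        ≤ |φ (u x) * ((q - 1) * |w x| ^ (q - 2) * z x)| := neg_le_abs _
      _ = |φ (u x)| * ((q - 1) * |w x| ^ (q - 2) * |z x|) := by
        rw [abs_mul, abs_mul, abs_mul, habs, abs_of_nonneg hq1]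
      _ ≤ |u x| * ((q - 1) * |w x| ^ (q - 2) * |z x|) := by
        refine mul_le_mul_of_nonneg_right (hφ _) ?_
        positivity
      _ = (q - 1) * (|u x| * |w x| ^ (q - 2) * |z x|) := by ring
  · have hline : Tendsto (fun t : ℝ => x + t • v) (𝓝 0) (𝓝 x) := by
      have : Continuous fun t : ℝ => x + t • v := by fun_prop
      simpa using this.tendsto 0
    unfold HasLineDerivAt
    by_cases hx : x ∈ Ω
    · have h1 : HasDerivAt (fun t : ℝ => u (x + t • v)) (w x) 0 := hdu x hx
      have h2 : HasDerivAt (fun t : ℝ => w (x + t • v)) (z x) 0 := hdw x hx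
      have h3 := (hφd (u (x + (0 : ℝ) • v))).comp (0 : ℝ) h1
      have h4 := (hasDerivAt_abs_rpow_mul_self hq (w (x + (0 : ℝ) • v))).comp (0 : ℝ) h2
      have h5 := h3.mul h4
      refine (h5.congr_of_eventuallyEq ?_).congr_deriv ?_
      · filter_upwards [hline.eventually (hΩ.mem_nhds hx)] with t ht
        simp [indicator_of_mem ht]
      · have : |w x| ^ q = |w x| ^ (q - 2) * (w x * w x) := by
          rcases eq_or_ne (w x) 0 with h0 | h0
          · rw [h0, abs_zero, Real.zero_rpow (by linarith)]; simp
          · rw [Real.rpow_sub (abs_pos.2 h0) q 2, Real.rpow_two, sq_abs]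
            field_simp
        rw [indicator_of_mem hx, this]
        simp
        ring
    · rw [indicator_of_notMem hx]
      refine (hasDerivAt_const (0 : ℝ) (0 : ℝ)).congr_of_eventuallyEq ?_
      filter_upwards [hline.eventually (eventually_abs_lt_of_notMem hu h0 hx hδ)] with t ht
      by_cases htΩ : x + t • v ∈ Ω
      · simp [indicator_of_mem htΩ, hφ0 _ (ht htΩ)]
      · simp [indicator_of_notMem htΩ]

theorem setIntegral_abs_rpow_le {Ω : Set E} (hΩ : IsOpen Ω) (hμ : μ Ω < ⊤)
    {u w z : E → ℝ} {v : E} {q B : ℝ} (hq : 4 ≤ q)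
    (hu : ContinuousOn u (closure Ω)) (h0 : ∀ x ∈ frontier Ω, u x = 0)
    (hw : ContinuousOn w Ω) (hz : ContinuousOn z Ω)
    (hdu : ∀ x ∈ Ω, HasLineDerivAt ℝ u (w x) x v)
    (hdw : ∀ x ∈ Ω, HasLineDerivAt ℝ w (z x) x v)
    (hBu : ∀ x ∈ Ω, |u x| ≤ B) (hBw : ∀ x ∈ Ω, |w x| ≤ B) (hBz : ∀ x ∈ Ω, |z x| ≤ B) :
    ∫ x in Ω, |w x| ^ q ∂μ ≤ (q - 1) * ∫ x in Ω, |u x| * |w x| ^ (q - 2) * |z x| ∂μ := by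
  have hδ : ∀ k : ℕ, (0 : ℝ) < 1 / (k + 1) := fun k => Nat.one_div_pos_of_nat
  choose φ h hh h01 hφd hφ hφ0 hh1 using fun k : ℕ => exists_smooth_threshold (hδ k)
  have huΩ : ContinuousOn u Ω := hu.mono subset_closure
  have hq0 : (0 : ℝ) ≤ q := by linarith
  have hpow : ContinuousOn (fun x => |w x| ^ q) Ω := hw.abs.rpow_const fun _ _ => Or.inr hq0
  have hnn : ∀ x, 0 ≤ |w x| ^ q := fun x => Real.rpow_nonneg (abs_nonneg _) _
  refine le_of_tendsto (tendsto_integral_of_dominated_convergence (μ := μ.restrict Ω)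
    (F := fun k x => h k (u x) * |w x| ^ q) (fun x => |w x| ^ q) (fun k => ?_) ?_ (fun k => ?_) ?_)
    (Eventually.of_forall fun k => setIntegral_threshold_mul_abs_rpow_le hΩ hμ hq (hδ k) hu h0 hw
      hz hdu hdw hBu hBw hBz (hh k) (h01 k) (hφd k) (hφ k) (hφ0 k))
  · exact (((hh k).comp_continuousOn huΩ).mul hpow).aestronglyMeasurable hΩ.measurableSet
  · refine integrableOn_of_continuousOn_of_bound hΩ hμ hpow (B := B ^ q) fun x hx => ?_
    rw [abs_of_nonneg (hnn x)]
    exact Real.rpow_le_rpow (abs_nonneg _) (hBw x hx) hq0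
  · refine ae_of_all _ fun x => ?_
    rw [Real.norm_eq_abs, abs_of_nonneg (mul_nonneg (h01 k _).1 (hnn x))]
    exact mul_le_of_le_one_left (hnn x) (h01 k _).2
  · rw [ae_restrict_iff' hΩ.measurableSet]
    filter_upwards [ae_lineDeriv_eq_zero_of_eq_zero (μ := μ) hΩ huΩ hw hdu] with x hx hxΩ
    rcases eq_or_ne (u x) 0 with hux | hux
    · simp [hx hxΩ hux, Real.zero_rpow (by linarith : q ≠ 0)]
    · refine tendsto_const_nhds.congr' ?_
      have hlim := tendsto_one_div_add_atTop_nhds_zero_nat.const_mul (2 : ℝ)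
      rw [mul_zero] at hlim
      filter_upwards [hlim.eventually_lt_const (abs_pos.2 hux)] with k hk
      rw [hh1 k _ hk.le, one_mul]

theorem setIntegral_abs_rpow_le_mul {Ω : Set E} (hΩ : IsOpen Ω) (hμ : μ Ω < ⊤)
    {u w z : E → ℝ} {v : E} {α β B M : ℝ} (hα : 0 ≤ α) (hαβ : α < β) (hβ : 2 ≤ β)
    (hu : ContinuousOn u (closure Ω)) (h0 : ∀ x ∈ frontier Ω, u x = 0)
    (hw : ContinuousOn w Ω) (hz : ContinuousOn z Ω)
    (hdu : ∀ x ∈ Ω, HasLineDerivAt ℝ u (w x) x v)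
    (hdw : ∀ x ∈ Ω, HasLineDerivAt ℝ w (z x) x v)
    (hBu : ∀ x ∈ Ω, |u x| ≤ B) (hBw : ∀ x ∈ Ω, |w x| ≤ B) (hBz : ∀ x ∈ Ω, |z x| ≤ B)
    (hM : ∀ x ∈ Ω, |u x| ≤ M) :
    ∫ x in Ω, |w x| ^ (2 * β) ∂μ ≤
      (2 * β - 1) ^ β * (M ^ (β - α) * ∫ x in Ω, |u x| ^ α * |z x| ^ β ∂μ) := by
  have huΩ : ContinuousOn u Ω := hu.mono subset_closure
  have hβ0 : 0 < β := by linarith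
  have hc : 0 ≤ 2 * β - 1 := by linarith
  have hB : ∀ x ∈ Ω, 0 ≤ B := fun x hx => (abs_nonneg _).trans (hBu x hx)
  have hpow : ∀ {f : E → ℝ} {r : ℝ}, 0 ≤ r → ContinuousOn f Ω →
      ContinuousOn (fun x => |f x| ^ r) Ω := fun hr hf => hf.abs.rpow_const fun _ _ => Or.inr hr
  have hnn : ∀ (t r : ℝ), 0 ≤ |t| ^ r := fun t r => Real.rpow_nonneg (abs_nonneg _) _
  have i1 : IntegrableOn (fun x => |w x| ^ (2 * β)) Ω μ := by
    refine integrableOn_of_continuousOn_of_bound hΩ hμ (hpow (by linarith) hw)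
      (B := B ^ (2 * β)) fun x hx => ?_
    rw [abs_of_nonneg (hnn _ _)]
    exact Real.rpow_le_rpow (abs_nonneg _) (hBw x hx) (by linarith)
  have i2 : IntegrableOn (fun x => |u x| ^ α * |z x| ^ β) Ω μ := by
    refine integrableOn_of_continuousOn_of_bound hΩ hμ ((hpow hα huΩ).mul (hpow hβ0.le hz))
      (B := B ^ α * B ^ β) fun x hx => ?_
    have := hB x hx
    rw [abs_of_nonneg (mul_nonneg (hnn _ _) (hnn _ _))]
    gcongr
    exacts [hBu x hx, hBz x hx]
  have i3 : IntegrableOn (fun x => |u x| * |w x| ^ (2 * β - 2) * |z x|) Ω μ := by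
    refine integrableOn_of_continuousOn_of_bound hΩ hμ
      ((huΩ.abs.mul (hpow (by linarith) hw)).mul hz.abs)
      (B := B * B ^ (2 * β - 2) * B) fun x hx => ?_
    have := hB x hx
    rw [abs_mul, abs_mul, abs_of_nonneg (hnn _ _), abs_abs, abs_abs]
    gcongr
    exacts [hBu x hx, by linarith, hBw x hx, hBz x hx]
  have h1 := setIntegral_abs_rpow_le hΩ hμ (q := 2 * β) (by linarith) hu h0 hw hz hdu hdw
    hBu hBw hBz
  have hyoung : (2 * β - 1) * ∫ x in Ω, |u x| * |w x| ^ (2 * β - 2) * |z x| ∂μ ≤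
      ∫ x in Ω, ((1 - 1 / β) * |w x| ^ (2 * β) +
        1 / β * (2 * β - 1) ^ β * M ^ (β - α) * (|u x| ^ α * |z x| ^ β)) ∂μ := by
    rw [← integral_const_mul]
    refine setIntegral_mono_on (i3.const_mul _) ((i1.const_mul _).add (i2.const_mul _))
      hΩ.measurableSet fun x hx => ?_
    have hconj : (β / (β - 1)).HolderConjugate β :=
      (Real.HolderConjugate.conjExponent (by linarith : 1 < β)).symm
    have hy := Real.young_inequality_of_nonneg (hnn (w x) (2 * β - 2))
      (mul_nonneg (mul_nonneg hc (abs_nonneg (u x))) (abs_nonneg (z x))) hconj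
    have hb1 : β - 1 ≠ 0 := by linarith
    have e1 : (|w x| ^ (2 * β - 2)) ^ (β / (β - 1)) = |w x| ^ (2 * β) := by
      rw [← Real.rpow_mul (abs_nonneg _)]
      congr 1
      field_simp
    have e2 : ((2 * β - 1) * |u x| * |z x|) ^ β = (2 * β - 1) ^ β * |u x| ^ β * |z x| ^ β := by
      rw [Real.mul_rpow (mul_nonneg hc (abs_nonneg _)) (abs_nonneg _),
        Real.mul_rpow hc (abs_nonneg _)]
    have e3 : |u x| ^ β ≤ M ^ (β - α) * |u x| ^ α := by
      calc |u x| ^ β = |u x| ^ (β - α) * |u x| ^ α := by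
            rw [← Real.rpow_add_of_nonneg (abs_nonneg _) (by linarith) hα]; simp
        _ ≤ _ := by
            gcongr
            exact hM x hx
    rw [e1, e2] at hy
    have e4 : |w x| ^ (2 * β) / (β / (β - 1)) = (1 - 1 / β) * |w x| ^ (2 * β) := by
      field_simp
    rw [e4] at hy
    calc (2 * β - 1) * (|u x| * |w x| ^ (2 * β - 2) * |z x|)
        = |w x| ^ (2 * β - 2) * ((2 * β - 1) * |u x| * |z x|) := by ring
      _ ≤ _ := hy
      _ ≤ (1 - 1 / β) * |w x| ^ (2 * β) +
          ((2 * β - 1) ^ β * (M ^ (β - α) * |u x| ^ α) * |z x| ^ β) / β := by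
        gcongr
      _ = _ := by ring
  rw [integral_add (i1.const_mul _) (i2.const_mul _), integral_const_mul, integral_const_mul]
    at hyoung
  have h2 := h1.trans hyoung
  have h3 : 1 / β * ∫ x in Ω, |w x| ^ (2 * β) ∂μ ≤ 1 / β *
      ((2 * β - 1) ^ β * (M ^ (β - α) * ∫ x in Ω, |u x| ^ α * |z x| ^ β ∂μ)) := by
    linarith
  exact le_of_mul_le_mul_left h3 (by positivity)

omit [MeasurableSpace E] [BorelSpace E] [FiniteDimensional ℝ E] in
theorem exists_contDiffWithinAt_eventually_fderiv_eq {F : Type*} [NormedAddCommGroup F]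
    [NormedSpace ℝ F] {Ω : Set E} (hΩ : IsOpen Ω) {f : E → F} {m : ℕ} {x : E}
    (hf : ContDiffWithinAt ℝ (m + 1) f Ω x) :
    ∃ f' : E → E →L[ℝ] F, ContDiffWithinAt ℝ m f' Ω x ∧ ∀ᶠ y in 𝓝[Ω] x, fderiv ℝ f y = f' y := by
  obtain ⟨s, hs, -, -, f', hf', hc⟩ :=
    (contDiffWithinAt_succ_iff_hasFDerivWithinAt' (by simp)).1 hf
  refine ⟨f', hc, ?_⟩
  filter_upwards [nhdsWithin_mono x (subset_insert x Ω) hs, self_mem_nhdsWithin] with y hy hyΩ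
  exact ((hf' y hy).hasFDerivAt (hΩ.mem_nhds hyΩ)).fderiv

omit [MeasurableSpace E] [BorelSpace E] in
theorem exists_bound_fderiv_of_contDiffOn_closure {Ω : Set E} (hΩ : IsOpen Ω)
    (hb : Bornology.IsBounded Ω) {u : E → ℝ} (hu : ContDiffOn ℝ 2 u (closure Ω)) :
    ∃ B, ∀ x ∈ Ω, ‖u x‖ ≤ B ∧ ‖fderiv ℝ u x‖ ≤ B ∧ ‖fderiv ℝ (fderiv ℝ u) x‖ ≤ B := by
  have : ∃ B, ∀ x ∈ closure Ω ∩ Ω,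
      ‖u x‖ ≤ B ∧ ‖fderiv ℝ u x‖ ≤ B ∧ ‖fderiv ℝ (fderiv ℝ u) x‖ ≤ B := by
    refine hb.isCompact_closure.induction_on (p := fun s => ∃ B, ∀ x ∈ s ∩ Ω,
      ‖u x‖ ≤ B ∧ ‖fderiv ℝ u x‖ ≤ B ∧ ‖fderiv ℝ (fderiv ℝ u) x‖ ≤ B) ⟨0, by simp⟩
      (fun s t hst ⟨B, hB⟩ => ⟨B, fun x hx => hB x ⟨hst hx.1, hx.2⟩⟩) ?_ fun x hx => ?_
    · rintro s t ⟨B, hB⟩ ⟨B', hB'⟩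
      refine ⟨max B B', ?_⟩
      rintro x ⟨hx | hx, hxΩ⟩
      · obtain ⟨h1, h2, h3⟩ := hB x ⟨hx, hxΩ⟩
        exact ⟨h1.trans (le_max_left _ _), h2.trans (le_max_left _ _), h3.trans (le_max_left _ _)⟩
      · obtain ⟨h1, h2, h3⟩ := hB' x ⟨hx, hxΩ⟩
        exact ⟨h1.trans (le_max_right _ _), h2.trans (le_max_right _ _),
          h3.trans (le_max_right _ _)⟩
    · have hux : ContDiffWithinAt ℝ ((1 : ℕ) + 1) u Ω x := by
        have := (hu x hx).mono (t := Ω) subset_closure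
        norm_num
        exact this
      obtain ⟨f', hf', he'⟩ := exists_contDiffWithinAt_eventually_fderiv_eq hΩ hux
      obtain ⟨f'', hf'', he''⟩ :=
        exists_contDiffWithinAt_eventually_fderiv_eq (m := 0) hΩ (by simpa using hf')
      have b0 := hux.continuousWithinAt.norm.eventually_lt_const (lt_add_one _)
      have b1 := hf'.continuousWithinAt.norm.eventually_lt_const (lt_add_one _)
      have b2 := hf''.continuousWithinAt.norm.eventually_lt_const (lt_add_one _)
      have he1 := eventually_eventually_nhdsWithin.2 he'
      have key : ∀ᶠ y in 𝓝[Ω] x, ‖u y‖ ≤ ‖u x‖ + 1 ∧ ‖fderiv ℝ u y‖ ≤ ‖f' x‖ + 1 ∧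
          ‖fderiv ℝ (fderiv ℝ u) y‖ ≤ ‖f'' x‖ + 1 := by
        filter_upwards [b0, b1, b2, he', he'', he1, self_mem_nhdsWithin]
          with y h0 h1 h2 h3 h4 h5 hyΩ
        rw [hΩ.nhdsWithin_eq hyΩ] at h5
        have h6 : fderiv ℝ (fderiv ℝ u) y = fderiv ℝ f' y := Filter.EventuallyEq.fderiv_eq h5
        rw [h6, h4, h3]
        exact ⟨h0.le, h1.le, h2.le⟩
      obtain ⟨V, hV, hVB⟩ := mem_nhdsWithin_iff_exists_mem_nhds_inter.1 key
      refine ⟨V, mem_nhdsWithin_of_mem_nhds hV,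
        max (‖u x‖ + 1) (max (‖f' x‖ + 1) (‖f'' x‖ + 1)), fun y hy => ?_⟩
      obtain ⟨h1, h2, h3⟩ := hVB hy
      exact ⟨h1.trans (le_max_left _ _), h2.trans ((le_max_left _ _).trans (le_max_right _ _)),
        h3.trans ((le_max_right _ _).trans (le_max_right _ _))⟩
  obtain ⟨B, hB⟩ := this
  exact ⟨B, fun x hx => hB x ⟨subset_closure hx, hx⟩⟩

omit [FiniteDimensional ℝ E] in
theorem integrableOn_curve_speed_rpow {Ω : Set E} (hΩ : IsOpen Ω) {u : E → ℝ} {B c : ℝ}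
    (hB : ∀ x ∈ Ω, ‖fderiv ℝ u x‖ ≤ B) (hB0 : 0 ≤ B) (hc : 0 ≤ c) (x h : E) (k : ℕ) (r : ℝ)
    (hr : 0 ≤ r) :
    IntegrableOn (fun s : ℝ => (k * s ^ (k - 1) * c *
      Ω.indicator (fun y => ‖fderiv ℝ u y‖) (x + s ^ k • h)) ^ r) (Ioc 0 1) := by
  have hG : Measurable (Ω.indicator fun y => ‖fderiv ℝ u y‖) :=
    (measurable_fderiv ℝ u).norm.indicator hΩ.measurableSet
  have hγ : Measurable fun s : ℝ => x + s ^ k • h :=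
    (by fun_prop : Continuous fun s : ℝ => x + s ^ k • h).measurable
  have hm : Measurable fun s : ℝ => (k * s ^ (k - 1) * c *
      Ω.indicator (fun y => ‖fderiv ℝ u y‖) (x + s ^ k • h)) ^ r :=
    ((by fun_prop : Measurable fun s : ℝ => (k : ℝ) * s ^ (k - 1) * c).mul
      (hG.comp hγ)).pow_const r
  refine IntegrableOn.of_bound (by simp) hm.aestronglyMeasurable ((k * 1 * c * B) ^ r) ?_
  refine (ae_restrict_iff' measurableSet_Ioc).2 (ae_of_all _ fun s hs => ?_)
  have hG0 : 0 ≤ Ω.indicator (fun y => ‖fderiv ℝ u y‖) (x + s ^ k • h) :=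
    indicator_nonneg (fun _ _ => norm_nonneg _) _
  have hGB : Ω.indicator (fun y => ‖fderiv ℝ u y‖) (x + s ^ k • h) ≤ B :=
    indicator_apply_le' (hB _) fun _ => hB0
  have hs0 := hs.1.le
  rw [Real.norm_eq_abs, abs_of_nonneg (by positivity)]
  have := pow_le_one₀ hs0 hs.2 (n := k - 1)
  gcongr

omit [FiniteDimensional ℝ E] in
theorem abs_le_integral_curve {Ω : Set E} (hΩ : IsOpen Ω) {u : E → ℝ} {B : ℝ}
    (hu : ContinuousOn u (closure Ω)) (h0 : ∀ x ∈ frontier Ω, u x = 0)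
    (hd : ∀ x ∈ Ω, DifferentiableAt ℝ u x) (hB : ∀ x ∈ Ω, ‖fderiv ℝ u x‖ ≤ B) {x h : E}
    (hx : x ∈ Ω) (hxh : x + h ∉ Ω) {k : ℕ} (hk : k ≠ 0) :
    |u x| ≤ ∫ s in Ioc (0 : ℝ) 1, (k * s ^ (k - 1) * ‖h‖ *
      Ω.indicator (fun y => ‖fderiv ℝ u y‖) (x + s ^ k • h)) := by
  set γ : ℝ → E := fun s => x + s ^ k • h with hγdef
  have hγ : Continuous γ := by fun_prop
  have hcomp : IsCompact (Icc (0 : ℝ) 1 ∩ γ ⁻¹' Ωᶜ) :=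
    isCompact_Icc.inter_right (hΩ.isClosed_compl.preimage hγ)
  have hne : (Icc (0 : ℝ) 1 ∩ γ ⁻¹' Ωᶜ).Nonempty := ⟨1, by simp, by simpa [hγdef] using hxh⟩
  set a := sInf (Icc (0 : ℝ) 1 ∩ γ ⁻¹' Ωᶜ) with ha
  obtain ⟨⟨ha0, ha1⟩, haΩ⟩ : a ∈ Icc (0 : ℝ) 1 ∩ γ ⁻¹' Ωᶜ := hcomp.sInf_mem hne
  have hlt : ∀ s, 0 ≤ s → s < a → γ s ∈ Ω := by
    intro s hs0 hsa
    by_contra hsΩ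
    exact absurd (csInf_le hcomp.bddBelow
      (⟨⟨hs0, hsa.le.trans ha1⟩, hsΩ⟩ : s ∈ Icc (0 : ℝ) 1 ∩ γ ⁻¹' Ωᶜ)) (not_le.2 hsa)
  have hγ0 : γ 0 = x := by simp [hγdef, hk]
  have hapos : 0 < a := by
    refine lt_of_le_of_ne ha0 fun h => haΩ ?_
    rw [← h, hγ0]
    exact hx
  have hacl : γ a ∈ closure Ω := by
    refine map_mem_closure hγ (s := Ico 0 a) ?_ fun s hs => hlt s hs.1 hs.2
    rw [closure_Ico hapos.ne]
    exact ⟨ha0, le_rfl⟩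
  have hua : u (γ a) = 0 := h0 _ ⟨hacl, fun h => haΩ (interior_subset h)⟩
  have hint := integrableOn_curve_speed_rpow hΩ hB ((norm_nonneg _).trans (hB x hx))
    (norm_nonneg h) x h k 1 zero_le_one
  simp only [Real.rpow_one] at hint
  have hderiv : ∀ s ∈ Ioo 0 a,
      HasDerivAt (fun s => u (γ s)) (fderiv ℝ u (γ s) ((k * s ^ (k - 1)) • h)) s := by
    intro s hs
    have h1 : HasDerivAt γ ((k * s ^ (k - 1)) • h) s :=
      ((hasDerivAt_pow k s).smul_const h).const_add x
    exact (hd _ (hlt s hs.1.le hs.2)).hasFDerivAt.comp_hasDerivAt s h1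
  have hI := (intervalIntegrable_iff_integrableOn_Ioc_of_le zero_le_one).2 hint
  have main := norm_sub_le_integral_of_norm_deriv_le_of_le (f := fun s => u (γ s))
    (B := fun s : ℝ => (k * s ^ (k - 1) * ‖h‖ *
      Ω.indicator (fun y => ‖fderiv ℝ u y‖) (x + s ^ k • h))) ha0 ?_
    (fun s hs => (hderiv s hs).differentiableAt.differentiableWithinAt) ?_
    (hI.mono_set (by rw [uIcc_of_le ha0, uIcc_of_le zero_le_one]; exact Icc_subset_Icc_right ha1))
  · rw [hua, hγ0, zero_sub, norm_neg, Real.norm_eq_abs] at main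
    refine main.trans ?_
    rw [← intervalIntegral.integral_of_le zero_le_one]
    refine intervalIntegral.integral_mono_interval le_rfl ha0 ha1 ?_ hI
    refine (ae_restrict_iff' measurableSet_Ioc).2 (ae_of_all _ fun s hs => ?_)
    have hG0 : 0 ≤ Ω.indicator (fun y => ‖fderiv ℝ u y‖) (x + s ^ k • h) :=
      indicator_nonneg (fun _ _ => norm_nonneg _) _
    have hs0 := hs.1.le
    simp only [Pi.zero_apply]
    positivity
  · refine hu.comp hγ.continuousOn fun s hs => ?_
    rcases hs.2.lt_or_eq with h | h
    · exact subset_closure (hlt s hs.1 h)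
    · rw [h]; exact hacl
  · refine ae_of_all _ fun s hs => ?_
    have hs0 := hs.1.le
    rw [(hderiv s hs).deriv, indicator_of_mem (hlt s hs.1.le hs.2 : x + s ^ k • h ∈ Ω)]
    refine (ContinuousLinearMap.le_opNorm _ _).trans_eq ?_
    rw [norm_smul, Real.norm_of_nonneg (by positivity)]
    ring

omit [FiniteDimensional ℝ E] in
theorem abs_rpow_le_integral_curve {Ω : Set E} (hΩ : IsOpen Ω) {u : E → ℝ} {B : ℝ}
    (hu : ContinuousOn u (closure Ω)) (h0 : ∀ x ∈ frontier Ω, u x = 0)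
    (hd : ∀ x ∈ Ω, DifferentiableAt ℝ u x) (hB : ∀ x ∈ Ω, ‖fderiv ℝ u x‖ ≤ B) {x h : E}
    (hx : x ∈ Ω) (hxh : x + h ∉ Ω) {k : ℕ} (hk : k ≠ 0) {q : ℝ} (hq : 1 ≤ q) :
    |u x| ^ q ≤ ∫ s in Ioc (0 : ℝ) 1, (k * s ^ (k - 1) * ‖h‖ *
      Ω.indicator (fun y => ‖fderiv ℝ u y‖) (x + s ^ k • h)) ^ q := by
  have hq0 : 0 ≤ q := zero_le_one.trans hq
  have hB0 := (norm_nonneg _).trans (hB x hx)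
  have hint := integrableOn_curve_speed_rpow hΩ hB hB0 (norm_nonneg h) x h k 1 zero_le_one
  simp only [Real.rpow_one] at hint
  have : IsProbabilityMeasure (volume.restrict (Ioc (0 : ℝ) 1)) := ⟨by simp⟩
  refine (Real.rpow_le_rpow (abs_nonneg _) (abs_le_integral_curve hΩ hu h0 hd hB hx hxh hk)
    hq0).trans ?_
  refine (convexOn_rpow hq).map_integral_le (Real.continuous_rpow_const hq0).continuousOn
    isClosed_Ici ?_ hint (integrableOn_curve_speed_rpow hΩ hB hB0 (norm_nonneg h) x h k q hq0)
  refine (ae_restrict_iff' measurableSet_Ioc).2 (ae_of_all _ fun s hs => ?_)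
  have hG0 : 0 ≤ Ω.indicator (fun y => ‖fderiv ℝ u y‖) (x + s ^ k • h) :=
    indicator_nonneg (fun _ _ => norm_nonneg _) _
  have hs0 := hs.1.le
  simp only [mem_Ici]
  positivity

theorem lintegral_comp_add_smul {g : E → ENNReal} (hg : Measurable g) (x : E) {r : ℝ}
    (hr : 0 < r) :
    ∫⁻ h, g (x + r • h) ∂μ =
      ENNReal.ofReal ((r ^ Module.finrank ℝ E)⁻¹) * ∫⁻ y, g y ∂μ := by
  have h1 := lintegral_map (μ := μ) (f := fun y => g (x + y)) (g := fun h : E => r • h)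
    (hg.comp (measurable_const_add x)) (measurable_const_smul r)
  rw [← h1, Measure.map_addHaar_smul μ hr.ne', lintegral_smul_measure, smul_eq_mul,
    abs_of_nonneg (by positivity), lintegral_add_left_eq_self]

theorem exists_abs_rpow_le_setIntegral_norm_fderiv_rpow [Nontrivial E] (μ : Measure E)
    [μ.IsAddHaarMeasure] {Ω : Set E} (hΩ : IsOpen Ω)
    (hb : Bornology.IsBounded Ω) {q : ℝ} (hq : (Module.finrank ℝ E : ℝ) < q) :
    ∃ C : ℝ, 0 ≤ C ∧ ∀ (u : E → ℝ) (B : ℝ), ContinuousOn u (closure Ω) →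
      (∀ x ∈ frontier Ω, u x = 0) → (∀ x ∈ Ω, DifferentiableAt ℝ u x) →
      (∀ x ∈ Ω, ‖fderiv ℝ u x‖ ≤ B) → ∀ x ∈ Ω,
        |u x| ^ q ≤ C * ∫ y in Ω, ‖fderiv ℝ u y‖ ^ q ∂μ := by
  set n := Module.finrank ℝ E with hn
  have hn1 : (1 : ℝ) ≤ n := by
    exact_mod_cast (Module.finrank_pos : 0 < Module.finrank ℝ E)
  have hq1 : 1 ≤ q := hn1.trans hq.le
  have hq0 : 0 ≤ q := zero_le_one.trans hq1
  obtain ⟨R, hR, hΩR⟩ := hb.subset_ball_lt 0 0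
  obtain ⟨c, hc⟩ := exists_norm_eq E (by positivity : 0 ≤ 3 * R)
  set Q := Metric.ball c R with hQdef
  have hQ0 : μ Q ≠ 0 := (Metric.measure_ball_pos μ c hR).ne'
  have hQtop : μ Q ≠ ⊤ := measure_ball_lt_top.ne
  have hQh : ∀ h ∈ Q, ‖h‖ ≤ 4 * R := by
    intro h hh
    rw [hQdef, mem_ball_iff_norm] at hh
    have := norm_le_norm_add_norm_sub' h c
    linarith
  have hQΩ : ∀ x ∈ Ω, ∀ h ∈ Q, x + h ∉ Ω := by
    intro x hx h hh hxh
    rw [hQdef, mem_ball_iff_norm] at hh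
    have h1 := mem_ball_zero_iff.1 (hΩR hx)
    have h2 := mem_ball_zero_iff.1 (hΩR hxh)
    have h3 : ‖c‖ ≤ ‖x + h‖ + ‖x‖ + ‖h - c‖ := by
      calc ‖c‖ = ‖(x + h) - x - (h - c)‖ := by congr 1; abel
        _ ≤ _ := (norm_sub_le _ _).trans (by gcongr; exact norm_sub_le _ _)
    linarith
  set k := ⌈q / (q - n)⌉₊ with hkdef
  have hqn : 0 < q - n := sub_pos.2 hq
  have hkq : q ≤ k * (q - n) := (div_le_iff₀ hqn).1 (Nat.le_ceil _)
  have hk : k ≠ 0 := by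
    rintro h
    rw [h] at hkq
    simp at hkq
    linarith
  have hk1 : ((k - 1 : ℕ) : ℝ) = k - 1 := by
    rw [Nat.cast_sub (Nat.one_le_iff_ne_zero.2 hk), Nat.cast_one]
  refine ⟨(k * (4 * R)) ^ q / (μ Q).toReal, by positivity, fun u B hu h0 hd hB x hx => ?_⟩
  have hB0 := (norm_nonneg _).trans (hB x hx)
  set G := Ω.indicator fun y => ‖fderiv ℝ u y‖ with hGdef
  have hG : Measurable G := (measurable_fderiv ℝ u).norm.indicator hΩ.measurableSet
  have hG0 : ∀ y, 0 ≤ G y := fun y => indicator_nonneg (fun _ _ => norm_nonneg _) _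
  set g : E → ENNReal := fun y => ENNReal.ofReal (G y ^ q)
  have hg : Measurable g := (hG.pow_const q).ennreal_ofReal
  have hpt : ∀ h ∈ Q, ENNReal.ofReal (|u x| ^ q) ≤ ∫⁻ s in Ioc (0 : ℝ) 1,
      ENNReal.ofReal ((k * (4 * R)) ^ q * (s ^ (k - 1)) ^ q) * g (x + s ^ k • h) := by
    intro h hh
    refine (ENNReal.ofReal_le_ofReal (abs_rpow_le_integral_curve hΩ hu h0 hd hB hx
      (hQΩ x hx h hh) hk hq1)).trans ?_
    rw [ofReal_integral_eq_lintegral_ofReal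
      (integrableOn_curve_speed_rpow hΩ hB hB0 (norm_nonneg h) x h k q hq0)]
    · refine setLIntegral_mono' measurableSet_Ioc fun s hs => ?_
      have hs0 := hs.1.le
      have := hG0 (x + s ^ k • h)
      rw [← ENNReal.ofReal_mul (by positivity)]
      refine ENNReal.ofReal_le_ofReal ?_
      rw [← Real.mul_rpow (by positivity) (by positivity),
        ← Real.mul_rpow (by positivity) (by positivity)]
      refine Real.rpow_le_rpow (by positivity) ?_ hq0
      refine mul_le_mul_of_nonneg_right ?_ this
      calc k * s ^ (k - 1) * ‖h‖ ≤ k * s ^ (k - 1) * (4 * R) := by gcongr; exact hQh h hh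
        _ = k * (4 * R) * s ^ (k - 1) := by ring
    · refine (ae_restrict_iff' measurableSet_Ioc).2 (ae_of_all _ fun s hs => ?_)
      have hs0 := hs.1.le
      have := hG0 (x + s ^ k • h)
      simp only [Pi.zero_apply]
      positivity
  have hmeas : Measurable (Function.uncurry fun (h : E) (s : ℝ) =>
      ENNReal.ofReal ((k * (4 * R)) ^ q * (s ^ (k - 1)) ^ q) * g (x + s ^ k • h)) := by
    refine Measurable.mul ?_ (hg.comp (by fun_prop : Continuous fun p : E × ℝ =>
      x + p.2 ^ k • p.1).measurable)
    exact (((measurable_snd.pow_const (k - 1)).pow_const q).const_mul _).ennreal_ofReal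
  have hmain : ENNReal.ofReal (|u x| ^ q) * μ Q ≤
      ENNReal.ofReal ((k * (4 * R)) ^ q) * ∫⁻ y, g y ∂μ := by
    calc ENNReal.ofReal (|u x| ^ q) * μ Q = ∫⁻ _ in Q, ENNReal.ofReal (|u x| ^ q) ∂μ := by
          rw [setLIntegral_const]
      _ ≤ ∫⁻ h in Q, (∫⁻ s in Ioc (0 : ℝ) 1,
          ENNReal.ofReal ((k * (4 * R)) ^ q * (s ^ (k - 1)) ^ q) * g (x + s ^ k • h)) ∂μ :=
          setLIntegral_mono' measurableSet_ball hpt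
      _ = ∫⁻ s in Ioc (0 : ℝ) 1, (∫⁻ h in Q,
          ENNReal.ofReal ((k * (4 * R)) ^ q * (s ^ (k - 1)) ^ q) * g (x + s ^ k • h) ∂μ) :=
          lintegral_lintegral_swap hmeas.aemeasurable
      _ ≤ ∫⁻ _ in Ioc (0 : ℝ) 1, ENNReal.ofReal ((k * (4 * R)) ^ q) * (∫⁻ y, g y ∂μ) := by
          refine setLIntegral_mono' measurableSet_Ioc fun s hs => ?_
          have hs0 := hs.1
          have hγ : Measurable fun h : E => g (x + s ^ k • h) :=
            hg.comp (by fun_prop : Continuous fun h : E => x + s ^ k • h).measurable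
          rw [lintegral_const_mul _ hγ]
          calc _ ≤ ENNReal.ofReal ((k * (4 * R)) ^ q * (s ^ (k - 1)) ^ q) *
                ∫⁻ h, g (x + s ^ k • h) ∂μ := by
                gcongr
                exact Measure.restrict_le_self
            _ = ENNReal.ofReal ((k * (4 * R)) ^ q * ((s ^ (k - 1)) ^ q * ((s ^ k) ^ n)⁻¹)) *
                ∫⁻ y, g y ∂μ := by
                rw [lintegral_comp_add_smul hg x (pow_pos hs0 k), ← mul_assoc,
                  ← ENNReal.ofReal_mul (by positivity), mul_assoc]
            _ ≤ _ := by
                gcongr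
                refine mul_le_of_le_one_right (by positivity) ?_
                rw [← div_eq_mul_inv, div_le_one (by positivity), ← Real.rpow_natCast,
                  ← Real.rpow_mul hs0.le, ← pow_mul, ← Real.rpow_natCast]
                refine Real.rpow_le_rpow_of_exponent_ge hs0 hs.2 ?_
                rw [hk1]
                push_cast
                linarith
      _ = _ := by simp
  have hgI : ∫⁻ y, g y ∂μ = ENNReal.ofReal (∫ y in Ω, ‖fderiv ℝ u y‖ ^ q ∂μ) := by
    rw [ofReal_integral_eq_lintegral_ofReal, ← lintegral_indicator hΩ.measurableSet]
    · refine lintegral_congr fun y => ?_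
      by_cases hy : y ∈ Ω
      · simp [g, hGdef, hy]
      · simp [g, hGdef, hy, Real.zero_rpow (by linarith : q ≠ 0)]
    · refine IntegrableOn.of_bound (hb.measure_lt_top) (C := B ^ q)
        ((measurable_fderiv ℝ u).norm.pow_const q).aestronglyMeasurable
        ((ae_restrict_iff' hΩ.measurableSet).2 (ae_of_all _ fun y hy => ?_))
      rw [Real.norm_eq_abs, abs_of_nonneg (by positivity)]
      exact Real.rpow_le_rpow (norm_nonneg _) (hB y hy) hq0
    · exact ae_of_all _ fun y => by positivity
  have hI0 : 0 ≤ ∫ y in Ω, ‖fderiv ℝ u y‖ ^ q ∂μ := integral_nonneg fun y => by positivity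
  rw [hgI, ← ENNReal.ofReal_mul (by positivity), ← ENNReal.ofReal_toReal hQtop,
    ← ENNReal.ofReal_mul (by positivity), ENNReal.ofReal_le_ofReal_iff (by positivity)] at hmain
  rw [div_mul_eq_mul_div, le_div_iff₀ (ENNReal.toReal_pos hQ0 hQtop)]
  exact hmain

end

theorem norm_le_sum_abs_apply_single {n : ℕ} (L : (Fin n → ℝ) →L[ℝ] ℝ) :
    ‖L‖ ≤ ∑ j, |L (Pi.single j 1)| := by
  refine L.opNorm_le_bound (Finset.sum_nonneg fun _ _ => abs_nonneg _) fun x => ?_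
  have hx : L x = ∑ j, x j * L (Pi.single j 1) := by
    conv_lhs => rw [pi_eq_sum_univ' x]
    simp
  rw [hx, Finset.sum_mul]
  refine (Finset.abs_sum_le_sum_abs _ _).trans (Finset.sum_le_sum fun j _ => ?_)
  rw [abs_mul, mul_comm]
  gcongr
  exact norm_le_pi_norm x j

theorem le_const_mul_rpow_of_le_mul_rpow {X S A C₀ α β : ℝ} (hX : 0 ≤ X) (hS : 0 ≤ S)
    (hA : 0 ≤ A) (hC₀ : 0 ≤ C₀) (hα : 0 ≤ α) (hβ : 0 < β)
    (h : X ≤ A * (((C₀ * X) ^ (1 / (2 * β))) ^ (β - α) * S)) :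
    X ≤ (A * C₀ ^ ((β - α) / (2 * β))) ^ (2 * β / (α + β)) *
      (S ^ (1 / (α + β))) ^ (2 * β) := by
  rcases hX.eq_or_lt with rfl | hX'
  · positivity
  have hαβ : 0 < α + β := by linarith
  have e1 : ((C₀ * X) ^ (1 / (2 * β))) ^ (β - α) =
      C₀ ^ ((β - α) / (2 * β)) * X ^ ((β - α) / (2 * β)) := by
    rw [← Real.rpow_mul (by positivity), ← Real.mul_rpow hC₀ hX]
    congr 1
    ring
  rw [e1] at h
  have h2 : X ^ ((α + β) / (2 * β)) ≤ A * C₀ ^ ((β - α) / (2 * β)) * S := by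
    have e2 : X ^ ((α + β) / (2 * β)) * X ^ ((β - α) / (2 * β)) = X := by
      rw [← Real.rpow_add hX', ← add_div, (by ring : α + β + (β - α) = 2 * β),
        div_self (by positivity), Real.rpow_one]
    refine le_of_mul_le_mul_right ?_ (Real.rpow_pos_of_pos hX' ((β - α) / (2 * β)))
    rw [e2]
    linarith
  have h3 := Real.rpow_le_rpow (by positivity) h2 (by positivity : 0 ≤ 2 * β / (α + β))
  rw [← Real.rpow_mul hX, Real.mul_rpow (by positivity) hS] at h3
  rw [← Real.rpow_mul hS]
  convert h3 using 2
  · have : (α + β) / (2 * β) * (2 * β / (α + β)) = 1 := by field_simp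
    rw [this, Real.rpow_one]
  · congr 1
    ring

/-- Theorem 3.2, case (ii): Let `Ω ⊂ ℝⁿ` be a bounded domain with
(Lipschitz) boundary, `β > α ≥ 0`, `β ≥ 2`, `α + β > n`, and `1 ≤ p ≤ 2β`.  There
are `C, C₁ > 0` such that for all `u ∈ C²(Ω̄)` with `u` and `∇u` vanishing on `∂Ω`
and every `i`, `‖D_i u‖_{L^p(Ω)}^p ≤ C [u]_{S̊₂}^{2β} + C₁`, where
`[u]_{S̊₂} = (∑ i ∫_Ω |u|^α |D_i² u|^β)^{1/(α+β)}`.  In particular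
`S̊_{2,α,β}(Ω) ⊂ W₀^{1,p}(Ω)`. -/
theorem stmt_9 (n : ℕ) (hn : 2 ≤ n) (Ω : Set (Fin n → ℝ))
    (hΩ_open : IsOpen Ω) (hΩ_bdd : Bornology.IsBounded Ω) (hΩ_conn : IsConnected Ω)
    (α β p : ℝ) (hα : 0 ≤ α) (hαβ : α < β) (hβ : 2 ≤ β) (hαβn : (n : ℝ) < α + β)
    (hp₁ : 1 ≤ p) (hp₂ : p ≤ 2 * β) :
    ∃ C C₁ : ℝ, 0 < C ∧ 0 < C₁ ∧
      ∀ u : (Fin n → ℝ) → ℝ, ContDiffOn ℝ 2 u (closure Ω) →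
        (∀ x ∈ frontier Ω, u x = 0) → (∀ x ∈ frontier Ω, fderiv ℝ u x = 0) →
        ∀ i : Fin n,
        (∫ x in Ω, |fderiv ℝ u x (Pi.single i 1)| ^ p) ≤
          C * ((∑ j : Fin n, ∫ x in Ω, |u x| ^ α *
            |fderiv ℝ (fun y => fderiv ℝ u y (Pi.single j 1)) x (Pi.single j 1)| ^ β)
            ^ (1 / (α + β))) ^ (2 * β) + C₁ := by
  have : Nontrivial (Fin n → ℝ) :=
    have : Nonempty (Fin n) := ⟨⟨0, by omega⟩⟩
    inferInstance
  have hq1 : 1 ≤ 2 * β := by linarith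
  have hq0 : 0 ≤ 2 * β := by linarith
  have hμ : volume Ω < ⊤ := hΩ_bdd.measure_lt_top
  obtain ⟨C, hC, hSob⟩ := exists_abs_rpow_le_setIntegral_norm_fderiv_rpow volume hΩ_open hΩ_bdd
    (q := 2 * β) (by rw [Module.finrank_fin_fun]; linarith)
  set C₀ := C * (n : ℝ) ^ (2 * β - 1) with hC₀def
  have hC₀ : 0 ≤ C₀ := by positivity
  have hA : 0 ≤ (2 * β - 1) ^ β := Real.rpow_nonneg (by linarith) _
  set K := ((2 * β - 1) ^ β * C₀ ^ ((β - α) / (2 * β))) ^ (2 * β / (α + β)) with hK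
  have hK0 : 0 ≤ K := by positivity
  refine ⟨K + 1, volume.real Ω + 1, by positivity, by positivity, fun u hu h0 _ i => ?_⟩
  obtain ⟨B, hB⟩ := exists_bound_fderiv_of_contDiffOn_closure hΩ_open hΩ_bdd hu
  have hB0 : 0 ≤ B := by
    obtain ⟨x, hx⟩ := hΩ_conn.nonempty
    exact (norm_nonneg _).trans (hB x hx).1
  have huc := hu.continuousOn
  have huΩ : ContDiffOn ℝ 2 u Ω := hu.mono subset_closure
  have hdu : ∀ x ∈ Ω, DifferentiableAt ℝ u x := fun x hx =>
    (huΩ.contDiffAt (hΩ_open.mem_nhds hx)).differentiableAt (by norm_num)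
  have hfd : ContDiffOn ℝ 1 (fderiv ℝ u) Ω := huΩ.fderiv_of_isOpen hΩ_open (by norm_num)
  have hdfd : ∀ x ∈ Ω, DifferentiableAt ℝ (fderiv ℝ u) x := fun x hx =>
    (hfd.contDiffAt (hΩ_open.mem_nhds hx)).differentiableAt (by norm_num)
  set w : Fin n → (Fin n → ℝ) → ℝ := fun j x => fderiv ℝ u x (Pi.single j 1) with hw
  set z : Fin n → (Fin n → ℝ) → ℝ := fun j x => fderiv ℝ (w j) x (Pi.single j 1) with hz
  have hsingle : ∀ j : Fin n, ‖(Pi.single j 1 : Fin n → ℝ)‖ = 1 := fun j => by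
    rw [Pi.norm_single, norm_one]
  have hwc : ∀ j, ContDiffOn ℝ 1 (w j) Ω := fun j => hfd.clm_apply contDiffOn_const
  have hzeq : ∀ j, ∀ x ∈ Ω,
      z j x = fderiv ℝ (fderiv ℝ u) x (Pi.single j 1) (Pi.single j 1) := by
    intro j x hx
    have := ((hdfd x hx).hasFDerivAt.clm_apply
      (hasFDerivAt_const (Pi.single j 1 : Fin n → ℝ) x)).fderiv
    simp only [hz, hw]
    rw [this]
    simp
  have hzc : ∀ j, ContinuousOn (z j) Ω := fun j =>
    ((hwc j).continuousOn_fderiv_of_isOpen hΩ_open (by norm_num)).clm_apply continuousOn_const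
  have hBu : ∀ x ∈ Ω, |u x| ≤ B := fun x hx => (hB x hx).1
  have hBw : ∀ j, ∀ x ∈ Ω, |w j x| ≤ B := fun j x hx => by
    have := (fderiv ℝ u x).le_opNorm (Pi.single j 1)
    rw [hsingle, mul_one] at this
    exact this.trans (hB x hx).2.1
  have hBz : ∀ j, ∀ x ∈ Ω, |z j x| ≤ B := fun j x hx => by
    have := (fderiv ℝ (fderiv ℝ u) x).le_opNorm₂ (Pi.single j 1) (Pi.single j 1)
    rw [hsingle, mul_one, mul_one] at this
    rw [hzeq j x hx]
    exact this.trans (hB x hx).2.2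
  have hdul : ∀ j, ∀ x ∈ Ω, HasLineDerivAt ℝ u (w j x) x (Pi.single j 1) := fun j x hx =>
    (hdu x hx).hasFDerivAt.hasLineDerivAt _
  have hdwl : ∀ j, ∀ x ∈ Ω, HasLineDerivAt ℝ (w j) (z j x) x (Pi.single j 1) := fun j x hx =>
    (((hwc j).contDiffAt (hΩ_open.mem_nhds hx)).differentiableAt
      (by norm_num)).hasFDerivAt.hasLineDerivAt _
  have hwI : ∀ j, ∀ r : ℝ, 0 ≤ r → IntegrableOn (fun x => |w j x| ^ r) Ω := fun j r hr => by
    refine integrableOn_of_continuousOn_of_bound hΩ_open hμ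
      ((hwc j).continuousOn.abs.rpow_const fun _ _ => Or.inr hr) (B := B ^ r) fun x hx => ?_
    rw [abs_of_nonneg (Real.rpow_nonneg (abs_nonneg _) _)]
    exact Real.rpow_le_rpow (abs_nonneg _) (hBw j x hx) hr
  set X := ∑ j, ∫ x in Ω, |w j x| ^ (2 * β) with hX
  set S := ∑ j, ∫ x in Ω, |u x| ^ α * |z j x| ^ β with hS
  have hXj : ∀ j, 0 ≤ ∫ x in Ω, |w j x| ^ (2 * β) := fun j =>
    integral_nonneg fun x => Real.rpow_nonneg (abs_nonneg _) _
  have hX0 : 0 ≤ X := Finset.sum_nonneg fun j _ => hXj j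
  have hS0 : 0 ≤ S := Finset.sum_nonneg fun j _ => integral_nonneg fun x =>
    mul_nonneg (Real.rpow_nonneg (abs_nonneg _) _) (Real.rpow_nonneg (abs_nonneg _) _)
  have hgrad : ∫ y in Ω, ‖fderiv ℝ u y‖ ^ (2 * β) ≤ (n : ℝ) ^ (2 * β - 1) * X := by
    rw [hX, ← integral_finsetSum _ fun j _ => hwI j _ hq0, ← integral_const_mul]
    refine integral_mono_of_nonneg (ae_of_all _ fun y => by positivity)
      ((integrable_finsetSum _ fun j _ => hwI j _ hq0).const_mul _) (ae_of_all _ fun y => ?_)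
    have h1 := Real.rpow_sum_le_const_mul_sum_rpow_of_nonneg (Finset.univ : Finset (Fin n))
      (f := fun j => |w j y|) hq1 fun j _ => abs_nonneg _
    rw [Finset.card_univ, Fintype.card_fin] at h1
    exact (Real.rpow_le_rpow (norm_nonneg _) (norm_le_sum_abs_apply_single _) hq0).trans h1
  have hM : ∀ x ∈ Ω, |u x| ≤ (C₀ * X) ^ (1 / (2 * β)) := by
    intro x hx
    have h1 : |u x| ^ (2 * β) ≤ C₀ * X := by
      refine (hSob u B huc h0 hdu (fun y hy => (hB y hy).2.1) x hx).trans ?_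
      rw [hC₀def, mul_assoc]
      gcongr
    rw [one_div]
    exact (Real.le_rpow_inv_iff_of_pos (abs_nonneg _) (by positivity) (by linarith)).2 h1
  have hXS : X ≤ (2 * β - 1) ^ β * (((C₀ * X) ^ (1 / (2 * β))) ^ (β - α) * S) := by
    conv_lhs => rw [hX]
    rw [hS, Finset.mul_sum, Finset.mul_sum]
    exact Finset.sum_le_sum fun j _ => setIntegral_abs_rpow_le_mul hΩ_open hμ hα hαβ hβ huc h0
      (hwc j).continuousOn (hzc j) (hdul j) (hdwl j) hBu (hBw j) (hBz j) hM
  have hfinal := le_const_mul_rpow_of_le_mul_rpow hX0 hS0 hA hC₀ hα (by linarith) hXS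
  have hp : ∫ x in Ω, |w i x| ^ p ≤ ∫ x in Ω, (|w i x| ^ (2 * β) + 1) := by
    refine integral_mono (hwI i p (by linarith))
      ((hwI i _ hq0).add (integrableOn_const hμ.ne)) fun x => ?_
    have hnn : 0 ≤ |w i x| ^ (2 * β) := Real.rpow_nonneg (abs_nonneg _) _
    rcases le_total |w i x| 1 with h | h
    · have := Real.rpow_le_one (abs_nonneg _) h (by linarith : 0 ≤ p)
      dsimp only
      linarith
    · have := Real.rpow_le_rpow_of_exponent_le h hp₂
      dsimp only
      linarith
  rw [integral_add (hwI i _ hq0) (integrableOn_const hμ.ne), setIntegral_const, smul_eq_mul,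
    mul_one] at hp
  have hXi : ∫ x in Ω, |w i x| ^ (2 * β) ≤ X :=
    Finset.single_le_sum (f := fun j => ∫ x in Ω, |w j x| ^ (2 * β)) (fun j _ => hXj j)
      (Finset.mem_univ i)
  have hpos : 0 ≤ (S ^ (1 / (α + β))) ^ (2 * β) := by positivity
  change ∫ x in Ω, |w i x| ^ p ≤ (K + 1) * (S ^ (1 / (α + β))) ^ (2 * β) + (volume.real Ω + 1)
  linarith
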